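/- Let (γ, ℓ, ℓ⁽²⁾) be coordinate hypersurface metric data on U, let Y⁺, Y⁻ be smooth symmetric fields, let [ρ_ℓ] and [J_a] be a smooth scalar and covector field on U, and let τ^{ab} be the shell energy–momentum tensor built from V_{ab} := Y⁺_{ab} − Y⁻_{ab}; set τ^b_a := τ^{bc}γ_{ca}. Define B := |det 𝔸|^{−1/2} ∂_a(|det 𝔸|^{1/2} τ^{ab}ℓ_b) − ½τ^{ab}(Y⁺_{ab} + Y⁻_{ab}) − [ρ_ℓ] and C_a := |det 𝔸|^{−1/2} ∂_b(|det 𝔸|^{1/2} τ^b_a) − ½τ^{bd}∂_aγ_{bd} − [J_a]. Given smooth gauge fields u : U → ℝ∖{0} and V = (V^a) : U → ℝ^m, let B' and C'_a be the same expressions built from the gauge-transformed data (γ, ℓ', ℓ⁽²⁾', Y'^±) and from [ρ'_ℓ] := [ρ_ℓ] + V^a[J_a], [J'_a] := u⁻¹[J_a]. Then C'_a = u⁻¹C_a and B' = B + V^aC_a. In particular, the shell field equations B = 0, C_a = 0 are gauge invariant. -/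

import Mathlib

open scoped BigOperators

noncomputable section

namespace HypData

variable {m : ℕ}

/-- Scalar field on ℝ^m. -/
abbrev Sc (m : ℕ) := (Fin m → ℝ) → ℝ
/-- One-index field. -/
abbrev Vec (m : ℕ) := (Fin m → ℝ) → Fin m → ℝ
/-- Two-index field. -/
abbrev Ten (m : ℕ) := (Fin m → ℝ) → Fin m → Fin m → ℝ
/-- Connection coefficients `Γ x c a b = Γ^c_{ab}` (first index upper). -/
abbrev Conn (m : ℕ) := (Fin m → ℝ) → Fin m → Fin m → Fin m → ℝ
/-- Three-index field. -/
abbrev Ten3 (m : ℕ) := (Fin m → ℝ) → Fin m → Fin m → Fin m → ℝ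

/-- Partial derivative of `f` in the `a`-th coordinate direction at `x`. -/
def pd (a : Fin m) (f : Sc m) (x : Fin m → ℝ) : ℝ :=
  fderiv ℝ f x (Pi.single a 1)

/-- Kronecker delta. -/
def kd (a b : Fin m) : ℝ := if a = b then 1 else 0

/-- Equations (EqP1)-(EqP4): `[[P,n],[nᵀ,n2]]` consists of the inverse blocks of
the block matrix `[[γ,ℓ],[ℓᵀ,ℓ2]]`. -/
def InvBlocks (γ : Fin m → Fin m → ℝ) (ℓ : Fin m → ℝ) (ℓ2 : ℝ)
    (P : Fin m → Fin m → ℝ) (n : Fin m → ℝ) (n2 : ℝ) : Prop :=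
  (∀ a b, (∑ c, P a c * γ c b) + n a * ℓ b = kd a b) ∧
  (∀ a, (∑ b, P a b * ℓ b) + ℓ2 * n a = 0) ∧
  ((∑ a, n a * ℓ a) + n2 * ℓ2 = 1) ∧
  (∀ a, (∑ b, γ a b * n b) + n2 * ℓ a = 0)

/-- ∇_a ω_b. -/
def covD1 (Γ : Conn m) (ω : Vec m) (x : Fin m → ℝ) (a b : Fin m) : ℝ :=
  pd a (fun y => ω y b) x - ∑ d, Γ x d a b * ω x d

/-- ∇_a X^b. -/
def covD1U (Γ : Conn m) (X : Vec m) (x : Fin m → ℝ) (a b : Fin m) : ℝ :=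
  pd a (fun y => X y b) x + ∑ d, Γ x b a d * X x d

/-- ∇_a T_{bc}. -/
def covD2 (Γ : Conn m) (T : Ten m) (x : Fin m → ℝ) (a b c : Fin m) : ℝ :=
  pd a (fun y => T y b c) x - (∑ d, Γ x d a b * T x d c) - (∑ d, Γ x d a c * T x b d)

/-- ∇_a T^{bc}. -/
def covD2U (Γ : Conn m) (T : Ten m) (x : Fin m → ℝ) (a b c : Fin m) : ℝ :=
  pd a (fun y => T y b c) x + (∑ d, Γ x b a d * T x d c) + (∑ d, Γ x c a d * T x b d)

/-- ∇_a S^b_c (first index of `S` upper, second lower). -/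
def covD11 (Γ : Conn m) (S : Ten m) (x : Fin m → ℝ) (a b c : Fin m) : ℝ :=
  pd a (fun y => S y b c) x + (∑ d, Γ x b a d * S x d c) - (∑ d, Γ x d a c * S x b d)

/-- ∇_a Q^{bcd}. -/
def covD3U (Γ : Conn m) (Q : Ten3 m) (x : Fin m → ℝ) (a b c d : Fin m) : ℝ :=
  pd a (fun y => Q y b c d) x + (∑ f, Γ x b a f * Q x f c d)
    + (∑ f, Γ x c a f * Q x b f d) + (∑ f, Γ x d a f * Q x b c f)

/-- Curvature `R^a_{bcd} = ∂_cΓ^a_{db} − ∂_dΓ^a_{cb} + Γ^a_{cf}Γ^f_{db} − Γ^a_{df}Γ^f_{cb}`. -/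
def curv (Γ : Conn m) (x : Fin m → ℝ) (a b c d : Fin m) : ℝ :=
  pd c (fun y => Γ y a d b) x - pd d (fun y => Γ y a c b) x
    + (∑ f, Γ x a c f * Γ x f d b) - (∑ f, Γ x a d f * Γ x f c b)

/-- `F_{ab} = ½(∂_aℓ_b − ∂_bℓ_a)`. -/
def Ff (ℓ : Vec m) (x : Fin m → ℝ) (a b : Fin m) : ℝ :=
  (pd a (fun y => ℓ y b) x - pd b (fun y => ℓ y a) x) / 2

/-- `U_{ab} = ½(n^c∂_cγ_{ab} + γ_{cb}∂_an^c + γ_{ac}∂_bn^c + ℓ_a∂_bn⁽²⁾ + ℓ_b∂_an⁽²⁾)`. -/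
def Uf (γ : Ten m) (ℓ : Vec m) (n : Vec m) (n2 : Sc m)
    (x : Fin m → ℝ) (a b : Fin m) : ℝ :=
  ((∑ c, (n x c * pd c (fun y => γ y a b) x + γ x c b * pd a (fun y => n y c) x
      + γ x a c * pd b (fun y => n y c) x))
    + ℓ x a * pd b n2 x + ℓ x b * pd a n2 x) / 2

/-- Metric hypersurface connection `Γ̊^c_{ab}`. -/
def Gam0 (γ : Ten m) (ℓ : Vec m) (P : Ten m) (n : Vec m)
    (x : Fin m → ℝ) (c a b : Fin m) : ℝ :=
  (∑ d, P x c d * (pd a (fun y => γ y b d) x + pd b (fun y => γ y a d) x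
      - pd d (fun y => γ y a b) x)) / 2
  + n x c * (pd a (fun y => ℓ y b) x + pd b (fun y => ℓ y a) x) / 2

/-- The connection `Γ̄^c_{ab} = Γ̊^c_{ab} − n^c Y_{ab}`. -/
def GamB (γ : Ten m) (ℓ : Vec m) (P : Ten m) (n : Vec m) (Y : Ten m)
    (x : Fin m → ℝ) (c a b : Fin m) : ℝ :=
  Gam0 γ ℓ P n x c a b - n x c * Y x a b

/-- `K_{ab} = n⁽²⁾Y_{ab} + U_{ab}`. -/
def Kf (γ : Ten m) (ℓ : Vec m) (n : Vec m) (n2 : Sc m) (Y : Ten m)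
    (x : Fin m → ℝ) (a b : Fin m) : ℝ :=
  n2 x * Y x a b + Uf γ ℓ n n2 x a b

/-- `φ_a = ½n⁽²⁾∂_aℓ⁽²⁾ + n^b(Y_{ab} + F_{ab})`. -/
def phif (ℓ : Vec m) (ℓ2 : Sc m) (n : Vec m) (n2 : Sc m) (Y : Ten m)
    (x : Fin m → ℝ) (a : Fin m) : ℝ :=
  n2 x * pd a ℓ2 x / 2 + ∑ b, n x b * (Y x a b + Ff ℓ x a b)

/-- `Ψ^b_a = P^{bc}(Y_{ac} + F_{ac}) + ½n^b∂_aℓ⁽²⁾`. -/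
def Psif (ℓ : Vec m) (ℓ2 : Sc m) (P : Ten m) (n : Vec m) (Y : Ten m)
    (x : Fin m → ℝ) (b a : Fin m) : ℝ :=
  (∑ c, P x b c * (Y x a c + Ff ℓ x a c)) + n x b * pd a ℓ2 x / 2

/-- Smoothness of a scalar field on `U`. -/
def SmSc (U : Set (Fin m → ℝ)) (f : Sc m) : Prop := ContDiffOn ℝ (⊤ : ℕ∞) f U
/-- Smoothness of a one-index field on `U`. -/
def SmVec (U : Set (Fin m → ℝ)) (f : Vec m) : Prop :=
  ∀ a, ContDiffOn ℝ (⊤ : ℕ∞) (fun x => f x a) U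
/-- Smoothness of a two-index field on `U`. -/
def SmTen (U : Set (Fin m → ℝ)) (f : Ten m) : Prop :=
  ∀ a b, ContDiffOn ℝ (⊤ : ℕ∞) (fun x => f x a b) U

/-- Smooth coordinate hypersurface metric data on `U`. -/
def MetricData (U : Set (Fin m → ℝ)) (γ : Ten m) (ℓ : Vec m) (ℓ2 : Sc m)
    (P : Ten m) (n : Vec m) (n2 : Sc m) : Prop :=
  SmTen U γ ∧ SmVec U ℓ ∧ SmSc U ℓ2 ∧ SmTen U P ∧ SmVec U n ∧ SmSc U n2 ∧
  (∀ x ∈ U, ∀ a b, γ x a b = γ x b a) ∧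
  (∀ x ∈ U, ∀ a b, P x a b = P x b a) ∧
  (∀ x ∈ U, InvBlocks (γ x) (ℓ x) (ℓ2 x) (P x) (n x) (n2 x))

/-- Gauge-transformed `ℓ`. -/
def gaugeL (γ : Ten m) (ℓ : Vec m) (u : Sc m) (V : Vec m) : Vec m :=
  fun x a => u x * (ℓ x a + ∑ b, V x b * γ x a b)

/-- Gauge-transformed `ℓ⁽²⁾`. -/
def gaugeL2 (γ : Ten m) (ℓ : Vec m) (ℓ2 : Sc m) (u : Sc m) (V : Vec m) : Sc m :=
  fun x => u x ^ 2 * (ℓ2 x + 2 * (∑ a, V x a * ℓ x a) + ∑ a, ∑ b, V x a * V x b * γ x a b)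

/-- Gauge-transformed `Y`. -/
def gaugeY (γ : Ten m) (ℓ : Vec m) (Y : Ten m) (u : Sc m) (V : Vec m) : Ten m :=
  fun x a b => u x * Y x a b + (ℓ x a * pd b u x + ℓ x b * pd a u x) / 2
    + ((u x * ∑ c, V x c * pd c (fun y => γ y a b) x)
      + (∑ c, γ x c b * pd a (fun y => u y * V y c) x)
      + (∑ c, γ x a c * pd b (fun y => u y * V y c) x)) / 2

/-- Gauge-transformed `P`. -/
def gaugeP (P : Ten m) (n : Vec m) (n2 : Sc m) (V : Vec m) : Ten m :=
  fun x a b => P x a b + n2 x * V x a * V x b - V x a * n x b - V x b * n x a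

/-- Gauge-transformed `n`. -/
def gaugeN (n : Vec m) (n2 : Sc m) (u : Sc m) (V : Vec m) : Vec m :=
  fun x a => (u x)⁻¹ * (n x a - n2 x * V x a)

/-- Gauge-transformed `n⁽²⁾`. -/
def gaugeN2 (n2 : Sc m) (u : Sc m) : Sc m :=
  fun x => ((u x) ^ 2)⁻¹ * n2 x

/-- Shell energy-momentum tensor `τ^{fa}` built pointwise from the jump `V_{ab}`. -/
def tauP (P : Fin m → Fin m → ℝ) (n : Fin m → ℝ) (n2 : ℝ) (V : Fin m → Fin m → ℝ)
    (f a : Fin m) : ℝ :=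
  (∑ c, ∑ d, (n f * P a c + n a * P f c) * n d * V c d)
  - (∑ c, ∑ d, (n2 * P f c * P a d + P f a * n c * n d) * V c d)
  + (n2 * P f a - n f * n a) * (∑ c, ∑ d, P c d * V c d)

/-- `τ^f_c = −(n⁽²⁾P^{bd} − n^bn^d)(δ^f_dV_{bc} − δ^f_cV_{bd})`. -/
def tauMixP (P : Fin m → Fin m → ℝ) (n : Fin m → ℝ) (n2 : ℝ)
    (V : Fin m → Fin m → ℝ) (f c : Fin m) : ℝ :=
  -(∑ b, ∑ d, (n2 * P b d - n b * n d) * (kd f d * V b c - kd f c * V b d))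

/-- `T^f = (P^{bf}n^c − P^{bc}n^f)V_{bc}`. -/
def tauVecP (P : Fin m → Fin m → ℝ) (n : Fin m → ℝ) (V : Fin m → Fin m → ℝ)
    (f : Fin m) : ℝ :=
  ∑ b, ∑ c, (P b f * n c - P b c * n f) * V b c

/-- The block matrix 𝔸. -/
def blockA (γ : Ten m) (ℓ : Vec m) (ℓ2 : Sc m) (x : Fin m → ℝ) :
    Matrix (Fin m ⊕ Unit) (Fin m ⊕ Unit) ℝ :=
  fun i j =>
    match i, j with
    | Sum.inl a, Sum.inl b => γ x a b
    | Sum.inl a, Sum.inr _ => ℓ x a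
    | Sum.inr _, Sum.inl b => ℓ x b
    | Sum.inr _, Sum.inr _ => ℓ2 x

/-- `det 𝔸` as a scalar field. -/
def detA (γ : Ten m) (ℓ : Vec m) (ℓ2 : Sc m) (x : Fin m → ℝ) : ℝ :=
  (blockA γ ℓ ℓ2 x).det

end HypData

namespace Statement19

open HypData

variable {m : ℕ}

/-- The scalar `B` of the shell field equations (in coordinate/divergence form). -/
def Bfield (γ : Ten m) (ℓ : Vec m) (ℓ2 : Sc m) (P : Ten m) (n : Vec m) (n2 : Sc m)
    (Yp Ym : Ten m) (ρ : Sc m) (x : Fin m → ℝ) : ℝ :=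
  (Real.sqrt (|detA γ ℓ ℓ2 x|))⁻¹
      * (∑ a, pd a (fun y => Real.sqrt (|detA γ ℓ ℓ2 y|)
          * ∑ b, tauP (P y) (n y) (n2 y) (fun c d => Yp y c d - Ym y c d) a b
              * ℓ y b) x)
    - (∑ a, ∑ b, tauP (P x) (n x) (n2 x) (fun c d => Yp x c d - Ym x c d) a b
        * (Yp x a b + Ym x a b)) / 2
    - ρ x

/-- The covector `C_a` of the shell field equations (in coordinate/divergence form). -/
def Cfield (γ : Ten m) (ℓ : Vec m) (ℓ2 : Sc m) (P : Ten m) (n : Vec m) (n2 : Sc m)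
    (Yp Ym : Ten m) (J : Vec m) (x : Fin m → ℝ) (a : Fin m) : ℝ :=
  (Real.sqrt (|detA γ ℓ ℓ2 x|))⁻¹
      * (∑ b, pd b (fun y => Real.sqrt (|detA γ ℓ ℓ2 y|)
          * ∑ c, tauP (P y) (n y) (n2 y) (fun c' d => Yp y c' d - Ym y c' d) b c
              * γ y c a) x)
    - (∑ b, ∑ d, tauP (P x) (n x) (n2 x) (fun c' d' => Yp x c' d' - Ym x c' d') b d
        * pd a (fun y => γ y b d) x) / 2
    - J x a

/-- The contraction `x^c y^d W_{cd}`. -/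
def contract (W : Fin m → Fin m → ℝ) (x y : Fin m → ℝ) : ℝ :=
  ∑ c, ∑ d, x c * y d * W c d

lemma contract_add_left (W : Fin m → Fin m → ℝ) (x x' y : Fin m → ℝ) :
    contract W (x + x') y = contract W x y + contract W x' y := by
  simp only [contract, ← Finset.sum_add_distrib, Pi.add_apply]
  exact Finset.sum_congr rfl fun _ _ => Finset.sum_congr rfl fun _ _ => by ring

lemma contract_smul_left (W : Fin m → Fin m → ℝ) (r : ℝ) (x y : Fin m → ℝ) :
    contract W (r • x) y = r * contract W x y := by
  simp only [contract, Finset.mul_sum, Pi.smul_apply, smul_eq_mul]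
  exact Finset.sum_congr rfl fun _ _ => Finset.sum_congr rfl fun _ _ => by ring

lemma contract_smul_field (W : Fin m → Fin m → ℝ) (r : ℝ) (x y : Fin m → ℝ) :
    contract (fun c d => r * W c d) x y = r * contract W x y := by
  simp only [contract, Finset.mul_sum]
  exact Finset.sum_congr rfl fun _ _ => Finset.sum_congr rfl fun _ _ => by ring

lemma contract_comm {W : Fin m → Fin m → ℝ} (hW : ∀ c d, W c d = W d c) (x y : Fin m → ℝ) :
    contract W x y = contract W y x := by
  rw [contract, contract, Finset.sum_comm]
  exact Finset.sum_congr rfl fun c _ => Finset.sum_congr rfl fun d _ => by rw [hW d c]; ring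

lemma contract_add_right {W : Fin m → Fin m → ℝ} (hW : ∀ c d, W c d = W d c)
    (x y y' : Fin m → ℝ) : contract W x (y + y') = contract W x y + contract W x y' := by
  rw [contract_comm hW, contract_add_left, contract_comm hW y, contract_comm hW y']

lemma contract_smul_right {W : Fin m → Fin m → ℝ} (hW : ∀ c d, W c d = W d c)
    (r : ℝ) (x y : Fin m → ℝ) : contract W x (r • y) = r * contract W x y := by
  rw [contract_comm hW, contract_smul_left, contract_comm hW y]

lemma tauP_eq_contract (P : Fin m → Fin m → ℝ) (n : Fin m → ℝ) (n2 : ℝ)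
    (W : Fin m → Fin m → ℝ) (f a : Fin m) :
    tauP P n n2 W f a = n f * contract W (P a) n + n a * contract W (P f) n
      - n2 * contract W (P f) (P a) - P f a * contract W n n
      + (n2 * P f a - n f * n a) * ∑ c, ∑ d, P c d * W c d := by
  have h1 : ∑ c, ∑ d, (n f * P a c + n a * P f c) * n d * W c d
      = n f * contract W (P a) n + n a * contract W (P f) n := by
    simp only [contract, Finset.mul_sum, ← Finset.sum_add_distrib]
    exact Finset.sum_congr rfl fun _ _ => Finset.sum_congr rfl fun _ _ => by ring
  have h2 : ∑ c, ∑ d, (n2 * P f c * P a d + P f a * n c * n d) * W c d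
      = n2 * contract W (P f) (P a) + P f a * contract W n n := by
    simp only [contract, Finset.mul_sum, ← Finset.sum_add_distrib]
    exact Finset.sum_congr rfl fun _ _ => Finset.sum_congr rfl fun _ _ => by ring
  rw [tauP, h1, h2]
  ring

lemma tauP_symm {P : Fin m → Fin m → ℝ} (n : Fin m → ℝ) (n2 : ℝ) {W : Fin m → Fin m → ℝ}
    (hP : ∀ a b, P a b = P b a) (hW : ∀ c d, W c d = W d c) (f a : Fin m) :
    tauP P n n2 W f a = tauP P n n2 W a f := by
  rw [tauP_eq_contract, tauP_eq_contract, contract_comm hW (P f) (P a), hP f a]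
  ring

lemma gaugeY_sub (γ : Ten m) (ℓ : Vec m) (Yp Ym : Ten m) (u : Sc m) (V : Vec m)
    (x : Fin m → ℝ) (a b : Fin m) :
    gaugeY γ ℓ Yp u V x a b - gaugeY γ ℓ Ym u V x a b = u x * (Yp x a b - Ym x a b) := by
  simp only [gaugeY]
  ring

/-- The shell energy-momentum tensor has gauge weight `-1`. -/
lemma tauP_gauge (P : Ten m) (n : Vec m) (n2 : Sc m) (u : Sc m) (V : Vec m)
    {W : Fin m → Fin m → ℝ} (hW : ∀ c d, W c d = W d c) {x : Fin m → ℝ} (hu : u x ≠ 0)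
    (f a : Fin m) :
    tauP (gaugeP P n n2 V x) (gaugeN n n2 u V x) (gaugeN2 n2 u x)
      (fun c d => u x * W c d) f a = (u x)⁻¹ * tauP (P x) (n x) (n2 x) W f a := by
  have hPv : ∀ b, gaugeP P n n2 V x b
      = P x b + ((n2 x * V x b - n x b) • V x + (-V x b) • n x) := by
    intro b
    funext c
    simp only [gaugeP, Pi.add_apply, Pi.smul_apply, smul_eq_mul]
    ring
  have hnv : gaugeN n n2 u V x = (u x)⁻¹ • (n x + (-n2 x) • V x) := by
    funext c
    simp only [gaugeN, Pi.add_apply, Pi.smul_apply, smul_eq_mul]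
    ring
  have htr : ∑ c, ∑ d, gaugeP P n n2 V x c d * (u x * W c d)
      = u x * (∑ c, ∑ d, P x c d * W c d + n2 x * contract W (V x) (V x)
          - 2 * contract W (n x) (V x)) := by
    have h2 : 2 * contract W (n x) (V x)
        = contract W (n x) (V x) + contract W (V x) (n x) := by
      rw [contract_comm hW (V x) (n x)]; ring
    rw [h2]
    simp only [contract, gaugeP, Finset.mul_sum, ← Finset.sum_add_distrib,
      ← Finset.sum_sub_distrib]
    exact Finset.sum_congr rfl fun _ _ => Finset.sum_congr rfl fun _ _ => by ring
  rw [tauP_eq_contract, tauP_eq_contract, htr]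
  simp only [contract_smul_field, hnv, hPv, contract_add_left, contract_smul_left,
    contract_add_right hW, contract_smul_right hW, contract_comm hW (V x) (n x),
    contract_comm hW (V x) (P x _), contract_comm hW (n x) (P x _), gaugeN2,
    Pi.add_apply, Pi.smul_apply, smul_eq_mul]
  field_simp
  ring

lemma detA_ne_zero {γ : Ten m} {ℓ : Vec m} {ℓ2 : Sc m} {P : Fin m → Fin m → ℝ}
    {n : Fin m → ℝ} {n2 : ℝ} {x : Fin m → ℝ} (hγ : ∀ a b, γ x a b = γ x b a)
    (h : InvBlocks (γ x) (ℓ x) (ℓ2 x) P n n2) : detA γ ℓ ℓ2 x ≠ 0 := by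
  obtain ⟨h1, h2, h3, h4⟩ := h
  have hmul : Matrix.fromBlocks (Matrix.of P) (Matrix.of fun a (_ : Unit) => n a)
      (Matrix.of fun (_ : Unit) a => n a) (Matrix.of fun (_ _ : Unit) => n2)
      * blockA γ ℓ ℓ2 x = 1 := by
    ext i j
    rcases i with i | i <;> rcases j with j | j
    · simpa [Matrix.mul_apply, blockA, Matrix.one_apply, kd] using h1 i j
    · simpa [Matrix.mul_apply, blockA, Matrix.one_apply, mul_comm] using h2 i
    · have := h4 j
      simp only [hγ j, mul_comm (γ x _ j)] at this
      simpa [Matrix.mul_apply, blockA, Matrix.one_apply] using this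
    · simpa [Matrix.mul_apply, blockA, Matrix.one_apply] using h3
  intro h0
  have := congrArg Matrix.det hmul
  rw [Matrix.det_mul, Matrix.det_one, show (blockA γ ℓ ℓ2 x).det = 0 from h0, mul_zero] at this
  exact zero_ne_one this

lemma detA_gauge {γ : Ten m} (ℓ : Vec m) (ℓ2 : Sc m) (u : Sc m) (V : Vec m)
    {x : Fin m → ℝ} (hγ : ∀ a b, γ x a b = γ x b a) :
    detA γ (gaugeL γ ℓ u V) (gaugeL2 γ ℓ ℓ2 u V) x = u x ^ 2 * detA γ ℓ ℓ2 x := by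
  set T : Matrix (Fin m ⊕ Unit) (Fin m ⊕ Unit) ℝ :=
    Matrix.fromBlocks 1 (Matrix.of fun a (_ : Unit) => u x * V x a) 0
      (Matrix.of fun (_ _ : Unit) => u x) with hT
  have hdet : T.det = u x := by
    rw [hT, Matrix.det_fromBlocks_zero₂₁]
    simp
  have hA : blockA γ ℓ ℓ2 x = Matrix.fromBlocks (Matrix.of (γ x))
      (Matrix.of fun a (_ : Unit) => ℓ x a) (Matrix.of fun (_ : Unit) a => ℓ x a)
      (Matrix.of fun (_ _ : Unit) => ℓ2 x) := by
    ext i j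
    rcases i with i | i <;> rcases j with j | j <;> rfl
  have key : blockA γ (gaugeL γ ℓ u V) (gaugeL2 γ ℓ ℓ2 u V) x
      = T.transpose * blockA γ ℓ ℓ2 x * T := by
    rw [hA, hT, Matrix.fromBlocks_transpose, Matrix.fromBlocks_multiply,
      Matrix.fromBlocks_multiply]
    ext i j
    rcases i with i | i <;> rcases j with j | j
    · simp [blockA]
    · simp only [blockA, gaugeL, Matrix.fromBlocks_apply₁₂]
      simp [Matrix.mul_apply]
      rw [mul_add, Finset.mul_sum, add_comm, mul_comm (u x)]
      congr 1
      exact Finset.sum_congr rfl fun _ _ => by ring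
    · simp only [blockA, gaugeL, Matrix.fromBlocks_apply₂₁]
      simp [Matrix.mul_apply]
      rw [mul_add, Finset.mul_sum, add_comm]
      congr 1
      exact Finset.sum_congr rfl fun _ _ => by rw [hγ j]; ring
    · simp only [blockA, gaugeL2, Matrix.fromBlocks_apply₂₂]
      have e1 : ∑ a, u x * V x a * ∑ b, γ x a b * (u x * V x b)
          = u x ^ 2 * ∑ a, ∑ b, V x a * V x b * γ x a b := by
        simp only [Finset.mul_sum]
        exact Finset.sum_congr rfl fun _ _ => Finset.sum_congr rfl fun _ _ => by ring
      have e2 : ∑ a, u x * V x a * ℓ x a = u x * ∑ a, V x a * ℓ x a := by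
        rw [Finset.mul_sum]
        exact Finset.sum_congr rfl fun _ _ => by ring
      have e3 : (∑ a, (∑ b, u x * V x b * γ x b a) * (u x * V x a))
          = ∑ a, u x * V x a * ∑ b, γ x a b * (u x * V x b) := by
        refine Finset.sum_congr rfl fun a _ => ?_
        rw [mul_comm]
        exact congrArg _ (Finset.sum_congr rfl fun b _ => by rw [hγ b a]; ring)
      have e4 : ∑ a, u x * ℓ x a * (u x * V x a) = u x ^ 2 * ∑ a, V x a * ℓ x a := by
        rw [Finset.mul_sum]
        exact Finset.sum_congr rfl fun _ _ => by ring
      simp only [Matrix.add_apply, Matrix.mul_apply, Matrix.transpose_apply, Matrix.of_apply,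
        Finset.univ_unique, Finset.sum_singleton, add_mul, Finset.sum_add_distrib]
      rw [e3, e1, e2, e4]
      ring
  rw [detA, key, Matrix.det_mul, Matrix.det_mul, Matrix.det_transpose, hdet, detA]
  ring

lemma sqrt_detA_gauge {γ : Ten m} (ℓ : Vec m) (ℓ2 : Sc m) (u : Sc m) (V : Vec m)
    {x : Fin m → ℝ} (hγ : ∀ a b, γ x a b = γ x b a) :
    Real.sqrt |detA γ (gaugeL γ ℓ u V) (gaugeL2 γ ℓ ℓ2 u V) x|
      = |u x| * Real.sqrt |detA γ ℓ ℓ2 x| := by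
  rw [detA_gauge ℓ ℓ2 u V hγ, abs_mul, abs_pow, Real.sqrt_mul (by positivity),
    Real.sqrt_sq (abs_nonneg _)]

lemma differentiableAt_detA {γ : Ten m} {ℓ : Vec m} {ℓ2 : (Fin m → ℝ) → ℝ} {x : Fin m → ℝ}
    (hγ : ∀ a b, DifferentiableAt ℝ (fun y => γ y a b) x)
    (hℓ : ∀ a, DifferentiableAt ℝ (fun y => ℓ y a) x) (hℓ2 : DifferentiableAt ℝ ℓ2 x) :
    DifferentiableAt ℝ (detA γ ℓ ℓ2) x := by
  have hA : ∀ i j, DifferentiableAt ℝ (fun y => blockA γ ℓ ℓ2 y i j) x := by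
    intro i j
    rcases i with i | i <;> rcases j with j | j
    exacts [hγ i j, hℓ i, hℓ j, hℓ2]
  have : detA γ ℓ ℓ2 = fun y => ∑ σ : Equiv.Perm (Fin m ⊕ Unit),
      ((Equiv.Perm.sign σ : ℤ) : ℝ) * ∏ i, blockA γ ℓ ℓ2 y (σ i) i := by
    funext y
    rw [detA, Matrix.det_apply']
  rw [this]
  fun_prop

lemma differentiableAt_sqrt_detA {γ : Ten m} {ℓ : Vec m} {ℓ2 : Sc m} {x : Fin m → ℝ}
    (hd : DifferentiableAt ℝ (detA γ ℓ ℓ2) x) (h0 : detA γ ℓ ℓ2 x ≠ 0) :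
    DifferentiableAt ℝ (fun y => Real.sqrt |detA γ ℓ ℓ2 y|) x :=
  (hd.abs h0).sqrt (abs_ne_zero.mpr h0)

lemma differentiableAt_tauP {P : Ten m} {n : Vec m} {n2 : (Fin m → ℝ) → ℝ} {W : Ten m}
    {x : Fin m → ℝ}
    (hP : ∀ a b, DifferentiableAt ℝ (fun y => P y a b) x)
    (hn : ∀ a, DifferentiableAt ℝ (fun y => n y a) x) (hn2 : DifferentiableAt ℝ n2 x)
    (hW : ∀ a b, DifferentiableAt ℝ (fun y => W y a b) x) (f a : Fin m) :
    DifferentiableAt ℝ (fun y => tauP (P y) (n y) (n2 y) (W y) f a) x := by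
  unfold tauP
  fun_prop

lemma pd_congr {f g : Sc m} {x : Fin m → ℝ} (h : f =ᶠ[nhds x] g) (a : Fin m) :
    pd a f x = pd a g x := by
  rw [pd, pd, h.fderiv_eq]

lemma pd_const_mul (a : Fin m) (r : ℝ) (f : Sc m) (x : Fin m → ℝ) :
    pd a (fun y => r * f y) x = r * pd a f x := by
  have : (fun y => r * f y) = r • f := rfl
  rw [pd, this, fderiv_const_smul_field]
  rfl

lemma pd_mul {f g : Sc m} {x : Fin m → ℝ} (hf : DifferentiableAt ℝ f x)
    (hg : DifferentiableAt ℝ g x) (a : Fin m) :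
    pd a (fun y => f y * g y) x = f x * pd a g x + g x * pd a f x := by
  rw [pd, fderiv_fun_mul hf hg]
  rfl

lemma pd_add {f g : Sc m} {x : Fin m → ℝ} (hf : DifferentiableAt ℝ f x)
    (hg : DifferentiableAt ℝ g x) (a : Fin m) :
    pd a (fun y => f y + g y) x = pd a f x + pd a g x := by
  rw [pd, fderiv_fun_add hf hg]
  rfl

lemma pd_sum {f : Fin m → Sc m} {x : Fin m → ℝ} (hf : ∀ c, DifferentiableAt ℝ (f c) x)
    (a : Fin m) : pd a (fun y => ∑ c, f c y) x = ∑ c, pd a (f c) x := by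
  rw [pd, fderiv_fun_sum fun c _ => hf c, FunLike.coe_sum, Finset.sum_apply]
  rfl

/-- `|u| / u` is locally constant where `u` is continuous and nonzero. -/
lemma eventually_abs_eq_sign_mul {u : Sc m} {x : Fin m → ℝ} (hc : ContinuousAt u x)
    (hu : u x ≠ 0) : ∀ᶠ y in nhds x, |u y| = (|u x| / u x) * u y := by
  rcases lt_or_gt_of_ne hu with h | h
  · filter_upwards [hc.eventually (gt_mem_nhds h)] with y hy
    rw [abs_of_neg hy, abs_of_neg h, neg_div, div_self hu, neg_one_mul]
  · filter_upwards [hc.eventually (lt_mem_nhds h)] with y hy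
    rw [abs_of_pos hy, abs_of_pos h, div_self hu, one_mul]

/-- The trace of the shell tensor against the inhomogeneous part of the gauge-transformed `Y`. -/
lemma sum_mul_gauge_terms {t g0 S : Fin m → Fin m → ℝ} (l v du : Fin m → ℝ) (u : ℝ)
    (dg : Fin m → Fin m → Fin m → ℝ) (w : Fin m → Fin m → ℝ)
    (ht : ∀ a b, t a b = t b a) (hg : ∀ a b, g0 a b = g0 b a) :
    ∑ a, ∑ b, t a b * (u * S a b + (l a * du b + l b * du a) + u * ∑ c, v c * dg c a b
        + ∑ c, g0 c b * w a c + ∑ c, g0 a c * w b c)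
      = u * ∑ a, ∑ b, t a b * S a b + 2 * ∑ a, du a * ∑ b, t a b * l b
        + u * ∑ c, v c * ∑ a, ∑ b, t a b * dg c a b
        + 2 * ∑ a, ∑ c, w a c * ∑ b, t a b * g0 b c := by
  have e1 : ∑ a, ∑ b, t a b * (l a * du b) = ∑ a, du a * ∑ b, t a b * l b := by
    rw [Finset.sum_comm]
    simp only [Finset.mul_sum]
    exact Finset.sum_congr rfl fun a _ => Finset.sum_congr rfl fun b _ => by rw [ht b a]; ring
  have e2 : ∑ a, ∑ b, t a b * (l b * du a) = ∑ a, du a * ∑ b, t a b * l b := by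
    simp only [Finset.mul_sum]
    exact Finset.sum_congr rfl fun a _ => Finset.sum_congr rfl fun b _ => by ring
  have e3 : ∑ a, ∑ b, t a b * (u * ∑ c, v c * dg c a b)
      = u * ∑ c, v c * ∑ a, ∑ b, t a b * dg c a b := by
    simp only [Finset.mul_sum]
    rw [Finset.sum_comm_cycle]
    exact Finset.sum_congr rfl fun c _ => Finset.sum_congr rfl fun a _ =>
      Finset.sum_congr rfl fun b _ => by ring
  have e4 : ∑ a, ∑ b, t a b * ∑ c, g0 c b * w a c
      = ∑ a, ∑ c, w a c * ∑ b, t a b * g0 b c := by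
    refine Finset.sum_congr rfl fun a _ => ?_
    simp only [Finset.mul_sum]
    rw [Finset.sum_comm]
    exact Finset.sum_congr rfl fun c _ => Finset.sum_congr rfl fun b _ => by rw [hg c b]; ring
  have e5 : ∑ a, ∑ b, t a b * ∑ c, g0 a c * w b c
      = ∑ a, ∑ c, w a c * ∑ b, t a b * g0 b c := by
    rw [Finset.sum_comm, ← e4]
    exact Finset.sum_congr rfl fun b _ => Finset.sum_congr rfl fun a _ => by
      rw [ht a b]; simp only [hg a]
  have e0 : ∑ a, ∑ b, t a b * (u * S a b) = u * ∑ a, ∑ b, t a b * S a b := by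
    simp only [Finset.mul_sum]
    exact Finset.sum_congr rfl fun a _ => Finset.sum_congr rfl fun b _ => by ring
  simp only [mul_add, Finset.sum_add_distrib]
  rw [e0, e1, e2, e3, e4, e5]
  ring

/-- Proposition 7 of the paper, gauge behaviour of the shell field
equations: `C'_a = u⁻¹C_a` and `B' = B + V^aC_a`; in particular the shell
equations are gauge invariant. -/
theorem statement19 (m : ℕ) (hm : 1 ≤ m) (U : Set (Fin m → ℝ)) (hU : IsOpen U)
    (γ : Ten m) (ℓ : Vec m) (ℓ2 : Sc m) (P : Ten m) (n : Vec m) (n2 : Sc m)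
    (hdata : MetricData U γ ℓ ℓ2 P n n2)
    (Yp Ym : Ten m) (hYpsm : SmTen U Yp) (hYmsm : SmTen U Ym)
    (hYps : ∀ x ∈ U, ∀ a b, Yp x a b = Yp x b a)
    (hYms : ∀ x ∈ U, ∀ a b, Ym x a b = Ym x b a)
    (ρ : Sc m) (J : Vec m) (hρ : SmSc U ρ) (hJ : SmVec U J)
    (u : Sc m) (V : Vec m) (husm : SmSc U u) (hVsm : SmVec U V)
    (hu : ∀ x ∈ U, u x ≠ 0) :
    -- C'_a = u⁻¹ C_a
    ((∀ x ∈ U, ∀ a,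
      Cfield γ (gaugeL γ ℓ u V) (gaugeL2 γ ℓ ℓ2 u V) (gaugeP P n n2 V)
          (gaugeN n n2 u V) (gaugeN2 n2 u) (gaugeY γ ℓ Yp u V) (gaugeY γ ℓ Ym u V)
          (fun y a' => (u y)⁻¹ * J y a') x a
        = (u x)⁻¹ * Cfield γ ℓ ℓ2 P n n2 Yp Ym J x a)
    -- B' = B + V^a C_a
    ∧ (∀ x ∈ U,
      Bfield γ (gaugeL γ ℓ u V) (gaugeL2 γ ℓ ℓ2 u V) (gaugeP P n n2 V)
          (gaugeN n n2 u V) (gaugeN2 n2 u) (gaugeY γ ℓ Yp u V) (gaugeY γ ℓ Ym u V)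
          (fun y => ρ y + ∑ a, V y a * J y a) x
        = Bfield γ ℓ ℓ2 P n n2 Yp Ym ρ x
          + ∑ a, V x a * Cfield γ ℓ ℓ2 P n n2 Yp Ym J x a)) := by
  obtain ⟨hγsm, hℓsm, hℓ2sm, hPsm, hnsm, hn2sm, hγ, hP, hinv⟩ := hdata
  set W : Ten m := fun y c d => Yp y c d - Ym y c d with hWdef
  have hW : ∀ y ∈ U, ∀ c d, W y c d = W y d c := fun y hy c d => by
    simp only [hWdef, hYps y hy c d, hYms y hy c d]
  have diffAt : ∀ {f : (Fin m → ℝ) → ℝ}, ContDiffOn ℝ (⊤ : ℕ∞) f U →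
      ∀ {x}, x ∈ U → DifferentiableAt ℝ f x := fun hf x hx =>
    (hf.contDiffAt (hU.mem_nhds hx)).differentiableAt (by simp)
  have hτ' : ∀ y ∈ U, ∀ a b, tauP (gaugeP P n n2 V y) (gaugeN n n2 u V y) (gaugeN2 n2 u y)
      (fun c d => gaugeY γ ℓ Yp u V y c d - gaugeY γ ℓ Ym u V y c d) a b
        = (u y)⁻¹ * tauP (P y) (n y) (n2 y) (W y) a b := fun y hy a b => by
    simp only [gaugeY_sub]
    exact tauP_gauge P n n2 u V (hW y hy) (hu y hy) a b
  have hs' : ∀ x ∈ U, ∀ᶠ y in nhds x, y ∈ U ∧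
      Real.sqrt |detA γ (gaugeL γ ℓ u V) (gaugeL2 γ ℓ ℓ2 u V) y|
        = (|u x| / u x) * u y * Real.sqrt |detA γ ℓ ℓ2 y| := fun x hx => by
    filter_upwards [hU.mem_nhds hx,
      eventually_abs_eq_sign_mul (diffAt husm hx).continuousAt (hu x hx)] with y hy hyu
    exact ⟨hy, by rw [sqrt_detA_gauge ℓ ℓ2 u V (hγ y hy), hyu]⟩
  refine ⟨fun x hx a => ?_, fun x hx => ?_⟩
  · have hux := hu x hx
    have hdiv : ∀ b, pd b (fun y => Real.sqrt (|detA γ (gaugeL γ ℓ u V) (gaugeL2 γ ℓ ℓ2 u V) y|)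
          * ∑ c, tauP (gaugeP P n n2 V y) (gaugeN n n2 u V y) (gaugeN2 n2 u y)
              (fun c d => gaugeY γ ℓ Yp u V y c d - gaugeY γ ℓ Ym u V y c d) b c * γ y c a) x
        = (|u x| / u x) * pd b (fun y => Real.sqrt (|detA γ ℓ ℓ2 y|)
            * ∑ c, tauP (P y) (n y) (n2 y) (W y) b c * γ y c a) x := fun b => by
      rw [← pd_const_mul]
      refine pd_congr ?_ b
      filter_upwards [hs' x hx] with y hy
      have huy := hu y hy.1
      simp only [hy.2, hτ' y hy.1, mul_assoc, ← Finset.mul_sum]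
      field_simp
    have habs := abs_ne_zero.mpr hux
    simp only [Cfield, hdiv, hτ' x hx, sqrt_detA_gauge ℓ ℓ2 u V (hγ x hx), mul_assoc,
      ← Finset.mul_sum]
    simp only [hWdef]
    rw [mul_inv]
    field_simp
  · have hux := hu x hx
    have habs := abs_ne_zero.mpr hux
    have hdet := detA_ne_zero (hγ x hx) (hinv x hx)
    have hsx : Real.sqrt |detA γ ℓ ℓ2 x| ≠ 0 :=
      Real.sqrt_ne_zero'.mpr (abs_pos.mpr hdet)
    have dγ := fun a b => diffAt (hγsm a b) hx
    have dℓ := fun a => diffAt (hℓsm a) hx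
    have dV := fun a => diffAt (hVsm a) hx
    have du := diffAt husm hx
    have ds := differentiableAt_sqrt_detA
      (differentiableAt_detA dγ dℓ (diffAt hℓ2sm hx)) hdet
    have dτ := fun a b => differentiableAt_tauP (fun a b => diffAt (hPsm a b) hx)
      (fun a => diffAt (hnsm a) hx) (diffAt hn2sm hx)
      (fun a b => ((diffAt (hYpsm a b) hx).sub (diffAt (hYmsm a b) hx) :
        DifferentiableAt ℝ (fun y => W y a b) x)) a b
    set s : Sc m := fun y => Real.sqrt |detA γ ℓ ℓ2 y| with hs
    set τ : Ten m := fun y => tauP (P y) (n y) (n2 y) (W y) with hτ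
    have dF : ∀ a, DifferentiableAt ℝ (fun y => s y * ∑ b, τ y a b * ℓ y b) x := fun a =>
      ds.mul (DifferentiableAt.fun_sum fun b _ => (dτ a b).mul (dℓ b))
    have dG : ∀ a c, DifferentiableAt ℝ (fun y => s y * ∑ b, τ y a b * γ y b c) x :=
      fun a c => ds.mul (DifferentiableAt.fun_sum fun b _ => (dτ a b).mul (dγ b c))
    have hdiv : ∀ a, pd a (fun y => Real.sqrt (|detA γ (gaugeL γ ℓ u V) (gaugeL2 γ ℓ ℓ2 u V) y|)
          * ∑ b, tauP (gaugeP P n n2 V y) (gaugeN n n2 u V y) (gaugeN2 n2 u y)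
              (fun c d => gaugeY γ ℓ Yp u V y c d - gaugeY γ ℓ Ym u V y c d) a b
              * gaugeL γ ℓ u V y b) x
        = (|u x| / u x) * (u x * (pd a (fun y => s y * ∑ b, τ y a b * ℓ y b) x
            + (∑ c, V x c * pd a (fun y => s y * ∑ b, τ y a b * γ y b c) x
              + s x * ∑ c, pd a (fun y => V y c) x * ∑ b, τ x a b * γ x b c))
          + s x * (∑ b, τ x a b * ℓ x b + ∑ c, V x c * ∑ b, τ x a b * γ x b c)
            * pd a u x) := fun a => by
      have hev : (fun y => Real.sqrt (|detA γ (gaugeL γ ℓ u V) (gaugeL2 γ ℓ ℓ2 u V) y|)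
          * ∑ b, tauP (gaugeP P n n2 V y) (gaugeN n n2 u V y) (gaugeN2 n2 u y)
              (fun c d => gaugeY γ ℓ Yp u V y c d - gaugeY γ ℓ Ym u V y c d) a b
              * gaugeL γ ℓ u V y b) =ᶠ[nhds x]
          fun y => (|u x| / u x) * (u y * (s y * ∑ b, τ y a b * ℓ y b
            + ∑ c, V y c * (s y * ∑ b, τ y a b * γ y b c))) := by
        filter_upwards [hs' x hx] with y hy
        have huy := hu y hy.1
        have hsum : ∑ b, (u y)⁻¹ * τ y a b * gaugeL γ ℓ u V y b
            = ∑ b, τ y a b * ℓ y b + ∑ c, V y c * ∑ b, τ y a b * γ y b c := by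
          simp only [gaugeL, Finset.mul_sum]
          rw [Finset.sum_comm, ← Finset.sum_add_distrib]
          refine Finset.sum_congr rfl fun b _ => ?_
          rw [mul_assoc, mul_left_comm (τ y a b), inv_mul_cancel_left₀ huy, mul_add,
            Finset.mul_sum]
          exact congrArg _ (Finset.sum_congr rfl fun c _ => by ring)
        have hsV : ∑ c, V y c * (s y * ∑ b, τ y a b * γ y b c)
            = s y * ∑ c, V y c * ∑ b, τ y a b * γ y b c := by
          rw [Finset.mul_sum]
          exact Finset.sum_congr rfl fun c _ => by ring
        simp only [hy.2, hτ' y hy.1]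
        rw [hsV]
        exact (congrArg _ hsum).trans (by simp only [hs]; ring)
      rw [pd_congr hev, pd_const_mul, pd_mul du ((dF a).fun_add
          (DifferentiableAt.fun_sum fun c _ => (dV c).fun_mul (dG a c))),
        pd_add (dF a) (DifferentiableAt.fun_sum fun c _ => (dV c).fun_mul (dG a c)),
        pd_sum fun c => (dV c).fun_mul (dG a c)]
      rw [Finset.sum_congr rfl fun c _ => pd_mul (dV c) (dG a c) a, Finset.sum_add_distrib]
      have e1 : ∑ c, s x * (∑ b, τ x a b * γ x b c) * pd a (fun y => V y c) x
          = s x * ∑ c, pd a (fun y => V y c) x * ∑ b, τ x a b * γ x b c := by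
        rw [Finset.mul_sum]
        exact Finset.sum_congr rfl fun c _ => by ring
      have e2 : ∑ c, V x c * (s x * ∑ b, τ x a b * γ x b c)
          = s x * ∑ c, V x c * ∑ b, τ x a b * γ x b c := by
        rw [Finset.mul_sum]
        exact Finset.sum_congr rfl fun c _ => by ring
      rw [e1, e2]
      ring
    have htr : ∑ a, ∑ b, τ x a b * (gaugeY γ ℓ Yp u V x a b + gaugeY γ ℓ Ym u V x a b)
        = u x * ∑ a, ∑ b, τ x a b * (Yp x a b + Ym x a b)
          + 2 * ∑ a, pd a u x * ∑ b, τ x a b * ℓ x b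
          + u x * ∑ c, V x c * ∑ a, ∑ b, τ x a b * pd c (fun y => γ y a b) x
          + 2 * ∑ a, ∑ c, (u x * pd a (fun y => V y c) x + V x c * pd a u x)
            * ∑ b, τ x a b * γ x b c := by
      rw [← sum_mul_gauge_terms (ℓ x) (V x) (fun a => pd a u x) (u x)
        (fun c a b => pd c (fun y => γ y a b) x)
        (fun a c => u x * pd a (fun y => V y c) x + V x c * pd a u x)
        (tauP_symm (n x) (n2 x) (hP x hx) (hW x hx)) (hγ x hx)]
      refine Finset.sum_congr rfl fun a _ => Finset.sum_congr rfl fun b _ => ?_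
      simp only [gaugeY, fun a c => pd_mul du (dV c) a]
      ring
    have hdivsum : ∑ a, (|u x| / u x) * (u x * (pd a (fun y => s y * ∑ b, τ y a b * ℓ y b) x
            + (∑ c, V x c * pd a (fun y => s y * ∑ b, τ y a b * γ y b c) x
              + s x * ∑ c, pd a (fun y => V y c) x * ∑ b, τ x a b * γ x b c))
          + s x * (∑ b, τ x a b * ℓ x b + ∑ c, V x c * ∑ b, τ x a b * γ x b c)
            * pd a u x)
        = (|u x| / u x) * (u x * (∑ a, pd a (fun y => s y * ∑ b, τ y a b * ℓ y b) x
            + (∑ a, ∑ c, V x c * pd a (fun y => s y * ∑ b, τ y a b * γ y b c) x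
              + s x * ∑ a, ∑ c, pd a (fun y => V y c) x * ∑ b, τ x a b * γ x b c))
          + s x * (∑ a, pd a u x * ∑ b, τ x a b * ℓ x b
            + ∑ a, ∑ c, V x c * pd a u x * ∑ b, τ x a b * γ x b c)) := by
      have e : ∀ a, s x * (∑ b, τ x a b * ℓ x b + ∑ c, V x c * ∑ b, τ x a b * γ x b c)
            * pd a u x
          = s x * (pd a u x * ∑ b, τ x a b * ℓ x b
            + ∑ c, V x c * pd a u x * ∑ b, τ x a b * γ x b c) := fun a => by
        rw [mul_assoc, add_mul, mul_comm (∑ b, τ x a b * ℓ x b), Finset.sum_mul]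
        congr 2
        exact Finset.sum_congr rfl fun c _ => by ring
      simp only [e, ← Finset.mul_sum, Finset.sum_add_distrib]
    have hw : ∑ a, ∑ c, (u x * pd a (fun y => V y c) x + V x c * pd a u x)
            * ∑ b, τ x a b * γ x b c
        = u x * ∑ a, ∑ c, pd a (fun y => V y c) x * ∑ b, τ x a b * γ x b c
          + ∑ a, ∑ c, V x c * pd a u x * ∑ b, τ x a b * γ x b c := by
      simp only [add_mul, Finset.sum_add_distrib, Finset.mul_sum, mul_assoc]
    have hB : Bfield γ ℓ ℓ2 P n n2 Yp Ym ρ x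
        = (s x)⁻¹ * ∑ a, pd a (fun y => s y * ∑ b, τ y a b * ℓ y b) x
          - (∑ a, ∑ b, τ x a b * (Yp x a b + Ym x a b)) / 2 - ρ x := rfl
    have hC : ∑ c, V x c * Cfield γ ℓ ℓ2 P n n2 Yp Ym J x c
        = (s x)⁻¹ * ∑ a, ∑ c, V x c * pd a (fun y => s y * ∑ b, τ y a b * γ y b c) x
          - (∑ c, V x c * ∑ a, ∑ b, τ x a b * pd c (fun y => γ y a b) x) / 2
          - ∑ c, V x c * J x c := by
      rw [Finset.sum_comm, Finset.mul_sum, Finset.sum_div, ← Finset.sum_sub_distrib,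
        ← Finset.sum_sub_distrib]
      refine Finset.sum_congr rfl fun c _ => ?_
      rw [← Finset.mul_sum, show Cfield γ ℓ ℓ2 P n n2 Yp Ym J x c
        = (s x)⁻¹ * ∑ a, pd a (fun y => s y * ∑ b, τ y a b * γ y b c) x
          - (∑ a, ∑ b, τ x a b * pd c (fun y => γ y a b) x) / 2 - J x c from rfl]
      ring
    have hτu : ∀ a b, tauP (gaugeP P n n2 V x) (gaugeN n n2 u V x) (gaugeN2 n2 u x)
        (fun c d => gaugeY γ ℓ Yp u V x c d - gaugeY γ ℓ Ym u V x c d) a b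
          = (u x)⁻¹ * τ x a b := hτ' x hx
    have hsu : Real.sqrt |detA γ (gaugeL γ ℓ u V) (gaugeL2 γ ℓ ℓ2 u V) x| = |u x| * s x :=
      sqrt_detA_gauge ℓ ℓ2 u V (hγ x hx)
    have hsx' : s x ≠ 0 := hsx
    rw [hB, hC]
    simp only [Bfield, hdiv, hτu, hsu, mul_assoc (u x)⁻¹, ← Finset.mul_sum _ _ (u x)⁻¹]
    rw [hdivsum, htr, hw, mul_inv]
    field_simp
    ring

end Statement19
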